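/- Let E ≥ 1, k, j : Fin E → ℕ, Q : ℕ × ℕ → ℝ nonnegative, and fix m ≤ E and types (κ_i, ι_i)_{i ∈ [m]}. Define m⁺(0)_{k'} = e⁺_{k'}, m⁻(0)_{j'} = e⁻_{j'}, m⁺(i) = m⁺(i−1) − 1_{κ_i}, m⁻(i) = m⁻(i−1) − 1_{ι_i}, and assume these stay nonnegative. For finitely supported margins (m⁻, m⁺) with common total E', set Ĉ(m⁻,m⁺) = E'! · ∑_e ( ∏_{(k',j')} Q(k',j')^{e(k',j')}/e(k',j')! ) · ( ∏_{j'} m⁻_{j'}! ) · ( ∏_{k'} m⁺_{k'}! ), the sum over matrices e with margins (m⁻, m⁺). Then ∑_{σ,τ ∈ Perm(Fin E)} ( ∏_{i=1}^{m} 1[k(σ(i)) = κ_i and j(τ(i)) = ι_i] ) · ∏_{ℓ ∈ Fin E} Q(k(σ(ℓ)), j(τ(ℓ))) = ( ∏_{i=1}^{m} m⁻(i−1)_{ι_i} · m⁺(i−1)_{κ_i} · Q(κ_i, ι_i) ) · Ĉ(m⁻(m), m⁺(m)). -/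

import Mathlib

open scoped BigOperators Classical

/-- The number of stubs with degree label `d`. -/
def stubCount (E : ℕ) (f : Fin E → ℕ) (d : ℕ) : ℕ :=
  (Finset.univ.filter fun ℓ => f ℓ = d).card

/-- The number of indices `i' < m` whose target label equals `d`. -/
def usedCount (M : ℕ) (κ : Fin M → ℕ) (m : ℕ) (d : ℕ) : ℕ :=
  (Finset.univ.filter fun i : Fin M => (i : ℕ) < m ∧ κ i = d).card

noncomputable def cntW {α : Type} {n : ℕ} (c : Fin n → α) : α →₀ ℕ :=
  ∑ i, Finsupp.single (c i) 1

noncomputable def factF {α : Type} (e : α →₀ ℕ) : ℕ := e.prod fun _ n => n.factorial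

lemma cntW_apply {α : Type} {n : ℕ} (c : Fin n → α) (d : α) :
    cntW c d = (Finset.univ.filter fun i => c i = d).card := by
  simp [cntW, Finsupp.finsetSum_apply, Finsupp.single_apply, Finset.sum_boole]

lemma cntW_mapDomain {α β : Type} {n : ℕ} (c : Fin n → α) (g : α → β) :
    Finsupp.mapDomain g (cntW c) = cntW (g ∘ c) := by
  simp [cntW, Finsupp.mapDomain_finsetSum, Finsupp.mapDomain_single]

lemma cntW_degree {α : Type} {n : ℕ} (c : Fin n → α) : (cntW c).degree = n := by
  simp [cntW, map_sum]

lemma cntW_append {α : Type} {m n : ℕ} (a : Fin m → α) (b : Fin n → α) :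
    cntW (Fin.append a b) = cntW a + cntW b := by
  simp [cntW, Fin.sum_univ_add]

lemma cntW_surj {α : Type} {n : ℕ} (e : α →₀ ℕ) (he : e.degree = n) :
    ∃ c : Fin n → α, cntW c = e := by
  induction n generalizing e with
  | zero => exact ⟨Fin.elim0, by rw [Finsupp.degree_eq_zero_iff] at he; simp [cntW, he]⟩
  | succ n ih =>
    have hne : e ≠ 0 := by rintro rfl; simp at he
    obtain ⟨x, hx⟩ := Finsupp.ne_iff.mp hne
    have hle : Finsupp.single x 1 ≤ e := by
      rw [Finsupp.single_le_iff]; simp at hx; omega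
    have hs : e - Finsupp.single x 1 + Finsupp.single x 1 = e := tsub_add_cancel_of_le hle
    obtain ⟨c, hc⟩ := ih (e - Finsupp.single x 1) (by
      have := congrArg Finsupp.degree hs
      simp only [map_add, Finsupp.degree_single] at this
      omega)
    refine ⟨Fin.snoc c x, ?_⟩
    rw [← hs, ← hc]
    simp [cntW, Fin.sum_univ_castSucc]

lemma cntW_eq_iff {α : Type} {n : ℕ} (a f : Fin n → α) :
    cntW a = cntW f ↔ ∃ σ : Equiv.Perm (Fin n), f ∘ σ = a := by
  constructor
  · intro h
    have hh : ∀ d, Fintype.card {i // a i = d} = Fintype.card {i // f i = d} := by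
      intro d
      rw [Fintype.card_subtype, Fintype.card_subtype, ← cntW_apply, ← cntW_apply, h]
    refine ⟨Equiv.ofFiberEquiv (f := a) (g := f) fun d => Fintype.equivOfCardEq (hh d), ?_⟩
    funext i
    exact Equiv.ofFiberEquiv_map _ i
  · rintro ⟨σ, rfl⟩
    exact Equiv.sum_comp σ fun i => Finsupp.single (f i) 1

noncomputable def wordsW {α : Type} {n : ℕ} (f : Fin n → α) : Finset (Fin n → α) :=
  Finset.univ.image fun σ : Equiv.Perm (Fin n) => f ∘ σ

lemma mem_wordsW {α : Type} {n : ℕ} (f a : Fin n → α) :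
    a ∈ wordsW f ↔ cntW a = cntW f := by
  rw [cntW_eq_iff]; simp [wordsW]

lemma cntW_support {α : Type} {n : ℕ} (f : Fin n → α) :
    (cntW f).support = Finset.univ.image f := by
  ext d
  simp [cntW_apply, Finset.filter_eq_empty_iff]

lemma prodW {α : Type} {n : ℕ} (c : Fin n → α) (Q : α → ℝ) :
    ∏ i, Q (c i) = (cntW c).prod fun p t => Q p ^ t := by
  rw [Finset.prod_comp, Finsupp.prod, cntW_support]
  exact Finset.prod_congr rfl fun d _ => by rw [cntW_apply]

lemma stab_card {α : Type} {n : ℕ} (f : Fin n → α) :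
    (Finset.univ.filter fun σ : Equiv.Perm (Fin n) => f ∘ σ = f).card = factF (cntW f) := by
  have := DomMulAct.stabilizer_card' f
  rw [Fintype.card_subtype] at this
  rw [factF, Finsupp.prod, cntW_support]
  convert this using 3 with d hd
  rw [cntW_apply, Fintype.card_subtype]

lemma fiber_card {α : Type} {n : ℕ} (f a : Fin n → α) (h : a ∈ wordsW f) :
    (Finset.univ.filter fun σ : Equiv.Perm (Fin n) => f ∘ σ = a).card = factF (cntW f) := by
  rw [mem_wordsW, cntW_eq_iff] at h
  obtain ⟨σ, rfl⟩ := h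
  rw [← stab_card]
  refine Finset.card_equiv (Equiv.mulRight σ⁻¹) fun ρ => ?_
  simp only [Finset.mem_filter, Finset.mem_univ, true_and, Equiv.coe_mulRight]
  constructor
  · intro h
    funext i
    have := congrFun h (σ⁻¹ i)
    simpa using this
  · intro h
    funext i
    have := congrFun h (σ i)
    simpa using this

lemma sum_permW {α : Type} {n : ℕ} (f : Fin n → α) (F : (Fin n → α) → ℝ) :
    ∑ σ : Equiv.Perm (Fin n), F (f ∘ σ) = (factF (cntW f) : ℝ) * ∑ a ∈ wordsW f, F a := by
  rw [Finset.sum_comp F (fun σ : Equiv.Perm (Fin n) => f ∘ σ), Finset.mul_sum]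
  refine Finset.sum_congr rfl fun a ha => ?_
  rw [fiber_card f a ha, nsmul_eq_mul]

lemma factF_pos {α : Type} (e : α →₀ ℕ) : 0 < factF e :=
  Finset.prod_pos fun _ _ => Nat.factorial_pos _

lemma factF_step {α : Type} (e : α →₀ ℕ) (x : α) (hx : 0 < e x) :
    factF e = e x * factF (e - Finsupp.single x 1) := by
  have h0 : ∀ g : α →₀ ℕ, g.support ⊆ e.support →
      factF g = ∏ d ∈ e.support, (g d).factorial := fun g hg =>
    Finsupp.prod_of_support_subset _ hg _ (by simp)
  have hxs : x ∈ e.support := by simp; omega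
  rw [h0 e le_rfl, h0 _ (by
    intro d; simp only [Finsupp.mem_support_iff, Finsupp.tsub_apply]; omega),
    ← Finset.mul_prod_erase _ _ hxs, ← Finset.mul_prod_erase _ _ hxs, ← mul_assoc]
  congr 1
  · simp only [Finsupp.tsub_apply, Finsupp.single_eq_same]
    exact (Nat.mul_factorial_pred (by omega)).symm
  · refine Finset.prod_congr rfl fun d hd => ?_
    have : x ≠ d := (Finset.ne_of_mem_erase hd).symm
    simp [Finsupp.single_apply, this]

lemma usedCount_all (m : ℕ) (κ : Fin m → ℕ) (d : ℕ) : usedCount m κ m d = cntW κ d := by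
  simp only [usedCount, cntW_apply, Fin.is_lt, true_and]; congr

lemma stubCount_eq (E : ℕ) (k : Fin E → ℕ) (d : ℕ) : stubCount E k d = cntW k d := by
  simp only [stubCount, cntW_apply]; congr

lemma usedCount_castSucc (m : ℕ) (κ : Fin (m+1) → ℕ) (i d : ℕ) (hi : i ≤ m) :
    usedCount (m+1) κ i d = usedCount m (fun t => κ t.castSucc) i d := by
  simp only [usedCount, Finset.card_filter, Fin.sum_univ_castSucc]
  simp; omega

lemma descW (p : ℕ →₀ ℕ) (m : ℕ) (κ : Fin m → ℕ) (h : cntW κ ≤ p) :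
    (∏ i : Fin m, (p (κ i) - usedCount m κ (i : ℕ) (κ i))) * factF (p - cntW κ) = factF p := by
  induction m with
  | zero => simp [cntW]
  | succ m ih =>
    have hc : cntW κ = cntW (fun t : Fin m => κ t.castSucc) + Finsupp.single (κ (Fin.last m)) 1 := by
      simp [cntW, Fin.sum_univ_castSucc]
    have h' : cntW (fun t : Fin m => κ t.castSucc) ≤ p := le_trans (by rw [hc]; exact le_self_add) h
    rw [← ih _ h', Fin.prod_univ_castSucc, mul_assoc]
    congr 1
    · refine Finset.prod_congr rfl fun i _ => ?_
      rw [usedCount_castSucc _ _ _ _ (by simp)]; rfl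
    · rw [factF_step (p - cntW fun t : Fin m => κ t.castSucc) (κ (Fin.last m)), hc, tsub_tsub]
      · rw [usedCount_castSucc _ _ _ _ (by simp), Fin.val_last, usedCount_all]; rfl
      · have := h (κ (Fin.last m))
        rw [hc] at this
        simp at this ⊢
        omega

lemma finsum_fst (e : ℕ × ℕ →₀ ℕ) (x : ℕ) :
    ∑ᶠ y : ℕ, e (x, y) = Finsupp.mapDomain Prod.fst e x := by
  rw [finsum_eq_sum_of_support_subset (s := e.support.image Prod.snd)]
  · rw [Finsupp.mapDomain, Finsupp.sum, Finsupp.finsetSum_apply]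
    simp only [Finsupp.single_apply]
    rw [← Finset.sum_filter]
    symm
    apply Finset.sum_bij_ne_zero (fun p _ _ => p.2)
    · intro p hp _
      simp only [Finset.mem_filter] at hp
      exact Finset.mem_image_of_mem _ hp.1
    · rintro ⟨a, b⟩ hp _ ⟨c, d⟩ hq _ h
      simp only [Finset.mem_filter] at hp hq
      ext <;> simp_all
    · intro y _ hy
      exact ⟨(x, y), by simpa using hy, hy, rfl⟩
    · rintro ⟨a, b⟩ hp _
      simp only [Finset.mem_filter] at hp
      simp [← hp.2]
  · intro y hy
    simp only [Function.mem_support] at hy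
    simp only [Finset.coe_image, Set.mem_image]
    exact ⟨(x, y), by simpa using hy, rfl⟩

lemma finsum_snd (e : ℕ × ℕ →₀ ℕ) (x : ℕ) :
    ∑ᶠ y : ℕ, e (y, x) = Finsupp.mapDomain Prod.snd e x := by
  have h := finsum_fst (Finsupp.mapDomain Prod.swap e) x
  rw [← Finsupp.mapDomain_comp] at h
  rw [show (Prod.snd : ℕ × ℕ → ℕ) = Prod.fst ∘ Prod.swap from rfl, ← h]
  refine finsum_congr fun y => ?_
  exact (Finsupp.mapDomain_apply Prod.swap_injective e (y, x)).symm

lemma degree_mapDomainW {α β : Type} (e : α →₀ ℕ) (g : α → β) :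
    (Finsupp.mapDomain g e).degree = e.degree := by
  induction e using Finsupp.induction_linear with
  | zero => simp
  | add a b ha hb => simp [Finsupp.mapDomain_add, ha, hb]
  | single a b => simp [Finsupp.mapDomain_single]

lemma fiber_sumW {n : ℕ} (Q : ℕ × ℕ → ℝ) (c0 : Fin n → ℕ × ℕ) :
    ∑ c ∈ wordsW c0, ∏ i, Q (c i) =
      (n.factorial : ℝ) * ∏ᶠ p, (Q p ^ (cntW c0 p) / ((cntW c0 p).factorial : ℝ)) := by
  have h := sum_permW c0 fun c => ∏ i, Q (c i)
  have h1 : ∀ σ : Equiv.Perm (Fin n), ∏ i, Q ((c0 ∘ σ) i) = ∏ i, Q (c0 i) := fun σ =>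
    Equiv.prod_comp σ fun i => Q (c0 i)
  simp only [h1, Finset.sum_const, Finset.card_univ, Fintype.card_perm, Fintype.card_fin,
    nsmul_eq_mul] at h
  have hpos : (factF (cntW c0) : ℝ) ≠ 0 := by exact_mod_cast (factF_pos _).ne'
  rw [finprod_eq_prod_of_mulSupport_subset (s := (cntW c0).support), Finset.prod_div_distrib]
  · rw [prodW, Finsupp.prod] at h
    have hf : ∏ p ∈ (cntW c0).support, ((cntW c0 p).factorial : ℝ) = factF (cntW c0) := by
      simp [factF, Finsupp.prod]
    rw [hf, ← mul_div_assoc, h]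
    field_simp
  · intro p hp
    by_contra hn
    apply hp
    have : cntW c0 p = 0 := by simpa using hn
    simp [this]

lemma mainW {n : ℕ} (Q : ℕ × ℕ → ℝ) (k' j' : Fin n → ℕ) (C : ℝ) (P R : ℕ → ℕ)
    (hP : ∀ x, P x = cntW k' x) (hR : ∀ x, R x = cntW j' x) :
    (n.factorial : ℝ) * ∑ᶠ e : {e : ℕ × ℕ →₀ ℕ //
        (∀ x : ℕ, (∑ᶠ y : ℕ, e (x, y)) = P x) ∧
        (∀ y : ℕ, (∑ᶠ x : ℕ, e (x, y)) = R y)},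
      (∏ᶠ p : ℕ × ℕ, (Q p ^ (e.1 p) / ((e.1 p).factorial : ℝ))) * C =
    (∑ a ∈ wordsW k', ∑ b ∈ wordsW j', ∏ i, Q (a i, b i)) * C := by
  obtain rfl : P = ⇑(cntW k') := funext hP
  obtain rfl : R = ⇑(cntW j') := funext hR
  let cn : (Fin n → ℕ) × (Fin n → ℕ) → (ℕ × ℕ →₀ ℕ) := fun ab => cntW fun i => (ab.1 i, ab.2 i)
  rw [finsum_subtype_eq_finsum_cond (f := fun e : ℕ × ℕ →₀ ℕ =>
    (∏ᶠ p : ℕ × ℕ, (Q p ^ (e p) / ((e p).factorial : ℝ))) * C)]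
  have key : ∀ e : ℕ × ℕ →₀ ℕ, ((∀ x : ℕ, (∑ᶠ y : ℕ, e (x, y)) = cntW k' x) ∧
        (∀ y : ℕ, (∑ᶠ x : ℕ, e (x, y)) = cntW j' y)) ↔
        (Finsupp.mapDomain Prod.fst e = cntW k' ∧ Finsupp.mapDomain Prod.snd e = cntW j') := by
    intro e
    simp only [finsum_fst, finsum_snd, Finsupp.ext_iff]
  rw [finsum_cond_eq_sum_of_cond_iff (fun e : ℕ × ℕ →₀ ℕ =>
    (∏ᶠ p : ℕ × ℕ, (Q p ^ (e p) / ((e p).factorial : ℝ))) * C)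
    (t := (wordsW k' ×ˢ wordsW j').image cn)]
  · rw [← Finset.sum_product', ← Finset.sum_fiberwise_of_maps_to (g := cn)
      (fun x hx => Finset.mem_image_of_mem cn hx), Finset.mul_sum, Finset.sum_mul]
    refine Finset.sum_congr rfl fun e he => ?_
    obtain ⟨⟨a0, b0⟩, hab, rfl⟩ := Finset.mem_image.mp he
    rw [← mul_assoc, ← fiber_sumW Q fun i => (a0 i, b0 i)]
    congr 1
    refine Finset.sum_bij' (fun c _ => (Prod.fst ∘ c, Prod.snd ∘ c))
      (fun ab _ i => (ab.1 i, ab.2 i)) ?_ ?_ ?_ ?_ ?_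
    · intro c hc
      rw [mem_wordsW] at hc
      simp only [Finset.mem_product, mem_wordsW] at hab
      simp only [Finset.mem_filter, Finset.mem_product, mem_wordsW]
      refine ⟨⟨?_, ?_⟩, hc⟩
      · rw [← cntW_mapDomain, hc, cntW_mapDomain]; exact hab.1
      · rw [← cntW_mapDomain, hc, cntW_mapDomain]; exact hab.2
    · intro ab h
      rw [mem_wordsW]
      exact (Finset.mem_filter.mp h).2
    · intro c _; rfl
    · intro ab _; rfl
    · intro c _; rfl
  · intro e _
    rw [key]
    constructor
    · rintro ⟨h1, h2⟩
      obtain ⟨c, rfl⟩ := cntW_surj (n := n) e (by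
        rw [← degree_mapDomainW e Prod.fst, h1, cntW_degree])
      rw [cntW_mapDomain] at h1 h2
      refine Finset.mem_image.mpr ⟨(Prod.fst ∘ c, Prod.snd ∘ c), ?_, rfl⟩
      simp only [Finset.mem_product, mem_wordsW]
      exact ⟨h1, h2⟩
    · intro h
      obtain ⟨⟨a, b⟩, hab, rfl⟩ := Finset.mem_image.mp h
      simp only [Finset.mem_product, mem_wordsW] at hab
      simp only [cn, cntW_mapDomain]
      exact hab

lemma prefixW {m n : ℕ} (k : Fin (m + n) → ℕ) (κ : Fin m → ℕ) (k' : Fin n → ℕ)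
    (h : cntW κ + cntW k' = cntW k) (H : (Fin (m + n) → ℕ) → ℝ) :
    ∑ a ∈ wordsW k, (if ∀ i, a (Fin.castAdd n i) = κ i then H a else 0) =
      ∑ a ∈ wordsW k', H (Fin.append κ a) := by
  rw [← Finset.sum_filter]
  symm
  refine Finset.sum_bij' (fun a _ => Fin.append κ a) (fun a _ i => a (Fin.natAdd m i)) ?_ ?_ ?_ ?_ ?_
  · intro a ha
    rw [mem_wordsW] at ha
    simp [mem_wordsW, cntW_append, ha, h]
  · intro a ha
    simp only [Finset.mem_filter, mem_wordsW] at ha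
    rw [mem_wordsW]
    have h1 : Fin.append κ (fun i => a (Fin.natAdd m i)) = a := by
      rw [← funext ha.2]; exact Fin.append_castAdd_natAdd
    have h2 := ha.1
    rw [← h1, cntW_append, ← h] at h2
    exact add_left_cancel h2
  · intro a _; funext i; simp
  · intro a ha
    simp only [Finset.mem_filter] at ha
    rw [← funext ha.2]; exact Fin.append_castAdd_natAdd
  · intro a _; rfl

lemma finprod_factW {n : ℕ} (k' : Fin n → ℕ) :
    ∏ᶠ x : ℕ, (((cntW k' x).factorial : ℕ) : ℝ) = factF (cntW k') := by
  rw [finprod_eq_prod_of_mulSupport_subset (s := (cntW k').support)]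
  · simp [factF, Finsupp.prod]
  · intro p hp
    by_contra hn
    apply hp
    have : cntW k' p = 0 := by simpa using hn
    simp [this]

/-- Summing the full wiring weight over all wirings whose first `m` edges have
the prescribed types `(κ_i, ι_i)` yields
`(∏_i m⁻(i−1)_{ι_i} · m⁺(i−1)_{κ_i} · Q(κ_i,ι_i)) · Ĉ(m⁻(m), m⁺(m))`, where
`m⁺(i)_{k'} = e⁺_{k'} − #{i' ≤ i : κ_{i'} = k'}`, `m⁻(i)_{j'} = e⁻_{j'} − #{i' ≤ i : ι_{i'} = j'}`
and `Ĉ(m⁻,m⁺) = E'! · ∑_e (∏ Q^e/e!) (∏ m⁻!) (∏ m⁺!)` over matrices `e` with margins `(m⁻,m⁺)`. -/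
theorem stmt4 (E : ℕ) (hE : 1 ≤ E) (k j : Fin E → ℕ) (Q : ℕ × ℕ → ℝ)
    (hQ : ∀ p, 0 ≤ Q p) (m : ℕ) (hm : m ≤ E) (κ ι : Fin m → ℕ)
    (hplusnn : ∀ i : ℕ, i ≤ m → ∀ k' : ℕ, usedCount m κ i k' ≤ stubCount E k k')
    (hminusnn : ∀ i : ℕ, i ≤ m → ∀ j' : ℕ, usedCount m ι i j' ≤ stubCount E j j') :
    (∑ σ : Equiv.Perm (Fin E), ∑ τ : Equiv.Perm (Fin E),
        if (∀ i : Fin m, k (σ (Fin.castLE hm i)) = κ i ∧ j (τ (Fin.castLE hm i)) = ι i)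
          then ∏ ℓ : Fin E, Q (k (σ ℓ), j (τ ℓ)) else 0) =
      (∏ i : Fin m,
          ((stubCount E j (ι i) - usedCount m ι (i : ℕ) (ι i) : ℕ) : ℝ) *
            ((stubCount E k (κ i) - usedCount m κ (i : ℕ) (κ i) : ℕ) : ℝ) * Q (κ i, ι i)) *
        (((E - m).factorial : ℝ) *
          ∑ᶠ e : {e : ℕ × ℕ →₀ ℕ //
              (∀ k' : ℕ, (∑ᶠ j' : ℕ, e (k', j')) = stubCount E k k' - usedCount m κ m k') ∧
              (∀ j' : ℕ, (∑ᶠ k' : ℕ, e (k', j')) = stubCount E j j' - usedCount m ι m j')},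
            (∏ᶠ p : ℕ × ℕ, (Q p ^ (e.1 p) / ((e.1 p).factorial : ℝ))) *
              (∏ᶠ j' : ℕ, (((stubCount E j j' - usedCount m ι m j').factorial : ℕ) : ℝ)) *
              (∏ᶠ k' : ℕ, (((stubCount E k k' - usedCount m κ m k').factorial : ℕ) : ℝ))) := by
  obtain ⟨n, rfl⟩ := Nat.exists_eq_add_of_le hm
  have hk : cntW κ ≤ cntW k := fun d => by
    have := hplusnn m le_rfl d
    rwa [usedCount_all, stubCount_eq] at this
  have hj : cntW ι ≤ cntW j := fun d => by
    have := hminusnn m le_rfl d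
    rwa [usedCount_all, stubCount_eq] at this
  have hk2 := add_tsub_cancel_of_le hk
  have hj2 := add_tsub_cancel_of_le hj
  obtain ⟨k', hk'⟩ := cntW_surj (n := n) (cntW k - cntW κ) (by
    have := congrArg Finsupp.degree hk2
    simp only [map_add, cntW_degree] at this
    omega)
  obtain ⟨j', hj'⟩ := cntW_surj (n := n) (cntW j - cntW ι) (by
    have := congrArg Finsupp.degree hj2
    simp only [map_add, cntW_degree] at this
    omega)
  have dk := descW _ m κ hk
  have dj := descW _ m ι hj
  rw [← hk'] at hk2 dk
  rw [← hj'] at hj2 dj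
  have ek : ∀ x, stubCount (m + n) k x - usedCount m κ m x = cntW k' x := fun x => by
    rw [hk', usedCount_all, stubCount_eq]; rfl
  have ej : ∀ x, stubCount (m + n) j x - usedCount m ι m x = cntW j' x := fun x => by
    rw [hj', usedCount_all, stubCount_eq]; rfl
  simp only [ek, ej, finprod_factW, mul_assoc (finprod _)]
  rw [Nat.add_sub_cancel_left, mainW Q k' j' _ (fun x => stubCount (m + n) k x - usedCount m κ m x)
    (fun x => stubCount (m + n) j x - usedCount m ι m x) ek ej]
  simp only [stubCount_eq]
  have hL : ∀ σ τ : Equiv.Perm (Fin (m + n)),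
      (if (∀ i : Fin m, k (σ (Fin.castLE hm i)) = κ i ∧ j (τ (Fin.castLE hm i)) = ι i)
          then ∏ ℓ : Fin (m + n), Q (k (σ ℓ), j (τ ℓ)) else 0) =
      (fun a : Fin (m + n) → ℕ => if ∀ i, a (Fin.castAdd n i) = κ i then
        (fun b : Fin (m + n) → ℕ => if ∀ i, b (Fin.castAdd n i) = ι i then
          ∏ ℓ, Q (a ℓ, b ℓ) else 0) (j ∘ τ) else 0) (k ∘ σ) := by
    intro σ τ
    simp only [forall_and, ite_and]
    rfl
  simp only [hL]
  have hτ : ∀ a : Fin (m + n) → ℕ, ∑ τ : Equiv.Perm (Fin (m + n)),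
      (if ∀ i, a (Fin.castAdd n i) = κ i then
        (fun b : Fin (m + n) → ℕ => if ∀ i, b (Fin.castAdd n i) = ι i then
          ∏ ℓ, Q (a ℓ, b ℓ) else 0) (j ∘ τ) else 0) =
      if ∀ i, a (Fin.castAdd n i) = κ i then
        (factF (cntW j) : ℝ) * ∑ b ∈ wordsW j', ∏ ℓ, Q (a ℓ, Fin.append ι b ℓ) else 0 := by
    intro a
    split_ifs
    · rw [sum_permW j (fun b : Fin (m + n) → ℕ => if ∀ i, b (Fin.castAdd n i) = ι i then
          ∏ ℓ, Q (a ℓ, b ℓ) else 0), prefixW j ι j' hj2]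
    · simp
  have h3 := fun σ : Equiv.Perm (Fin (m + n)) => hτ (k ∘ σ)
  simp only at h3 ⊢
  simp only [h3]
  rw [sum_permW k (fun a => if ∀ i, a (Fin.castAdd n i) = κ i then
        (factF (cntW j) : ℝ) * ∑ b ∈ wordsW j', ∏ ℓ, Q (a ℓ, Fin.append ι b ℓ) else 0),
    prefixW k κ k' hk2]
  simp only [Fin.prod_univ_add, Fin.append_left, Fin.append_right, ← Finset.mul_sum]
  rw [← dk, ← dj]
  push_cast
  simp only [Finset.prod_mul_distrib]
  ring
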